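/- arXiv:2412.12130 — 8 statements merged into one kernel-verified Lean document; each statement's English description precedes it below -/
import Mathlib

section
/- Let k ≥ 2 and suppose the nonnegative integers n, m, x with x ≥ 1 satisfy (L_{n+1}^{(k)})^x + (L_n^{(k)})^x − (L_{n−1}^{(k)})^x = L_m^{(k)} (with L_{−1}^{(2)} = −1 when k = 2 and n = 0). Then nx − 3 < m < (n + 3)x + 3. -/
/-- Auxiliary: `lucasAux k j` is the `k`-generalized Lucas number `L^{(k)}_{j + 2 - k}`. -/
def lucasAux (k : ℕ) : ℕ → ℤ
  | j =>
    if _h1 : j < k - 2 then 0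
    else if _h2 : j = k - 2 then 2
    else if _h3 : j = k - 1 then 1
    else ∑ i ∈ Finset.range k, lucasAux k (j - (i + 1))
termination_by j => j
decreasing_by omega

/-- The `k`-generalized Lucas sequence, indexed by the integers:
`L_{2-k} = ⋯ = L_{-1} = 0`, `L_0 = 2`, `L_1 = 1`, and
`L_n = L_{n-1} + ⋯ + L_{n-k}` for `n ≥ 2`; moreover `L_{-1} = -1` when `k = 2`
(the backwards extension of the recurrence). -/
def genLucas (k : ℕ) (n : ℤ) : ℤ :=
  if k = 2 ∧ n = -1 then -1
  else if 2 - (k : ℤ) ≤ n then lucasAux k (n - (2 - (k : ℤ))).toNat else 0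

theorem lucasAux_of_lt {d j : ℕ} (h : j < d) : lucasAux (d + 2) j = 0 := by
  rw [lucasAux, dif_pos (by omega)]

theorem lucasAux_zero_add (d : ℕ) : lucasAux (d + 2) d = 2 := by
  rw [lucasAux, dif_neg (by omega), dif_pos (by omega)]

theorem lucasAux_one_add (d : ℕ) : lucasAux (d + 2) (d + 1) = 1 := by
  rw [lucasAux, dif_neg (by omega), dif_neg (by omega), dif_pos (by omega)]

theorem lucasAux_rec (d j : ℕ) :
    lucasAux (d + 2) (j + d + 2) = ∑ i ∈ Finset.range (d + 2), lucasAux (d + 2) (j + i) := by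
  rw [lucasAux, dif_neg (by omega), dif_neg (by omega), dif_neg (by omega),
    ← Finset.sum_range_reflect]
  refine Finset.sum_congr rfl fun i hi => ?_
  have := Finset.mem_range.1 hi
  congr 1
  omega

theorem lucasAux_nonneg (d j : ℕ) : 0 ≤ lucasAux (d + 2) j := by
  induction j using Nat.strong_induction_on with
  | _ j ih =>
    rcases lt_trichotomy j d with h | h | h
    · rw [lucasAux_of_lt h]
    · rw [h, lucasAux_zero_add]; norm_num
    · rcases Nat.lt_or_ge j (d + 2) with h' | h'
      · obtain rfl : j = d + 1 := by omega
        rw [lucasAux_one_add]; norm_num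
      · obtain ⟨c, rfl⟩ := Nat.exists_eq_add_of_le' h'
        rw [← add_assoc, lucasAux_rec]
        refine Finset.sum_nonneg fun i hi => ih _ ?_
        have := Finset.mem_range.1 hi
        omega

theorem lucasAux_add_eq_two_mul (d j : ℕ) :
    lucasAux (d + 2) (j + d + 3) + lucasAux (d + 2) j = 2 * lucasAux (d + 2) (j + d + 2) := by
  have h1 : lucasAux (d + 2) (j + d + 3) =
      ∑ i ∈ Finset.range (d + 2), lucasAux (d + 2) (j + (i + 1)) := by
    rw [show j + d + 3 = (j + 1) + d + 2 by omega, lucasAux_rec]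
    exact Finset.sum_congr rfl fun i _ => by rw [add_assoc, add_comm 1 i]
  have h2 := Finset.sum_range_succ (fun i => lucasAux (d + 2) (j + i)) (d + 2)
  rw [Finset.sum_range_succ', ← h1, ← lucasAux_rec, ← add_assoc] at h2
  simp only [add_zero] at h2
  linarith

theorem lucasAux_succ_le_two_mul (d j : ℕ) :
    lucasAux (d + 2) (j + d + 3) ≤ 2 * lucasAux (d + 2) (j + d + 2) := by
  linarith [lucasAux_add_eq_two_mul d j, lucasAux_nonneg d j]

theorem lucasAux_add_le (d j : ℕ) :
    lucasAux (d + 2) (j + d) + lucasAux (d + 2) (j + d + 1) ≤ lucasAux (d + 2) (j + d + 2) := by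
  rw [lucasAux_rec, Finset.sum_range_succ, Finset.sum_range_succ, ← add_assoc j d 1]
  have := Finset.sum_nonneg fun i (_ : i ∈ Finset.range d) => lucasAux_nonneg d (j + i)
  linarith

theorem lucasAux_two_add (d : ℕ) : lucasAux (d + 2) (d + 2) = 3 := by
  have h := lucasAux_rec d 0
  rw [Finset.sum_range_succ, Finset.sum_range_succ, Finset.sum_eq_zero] at h
  · simpa [lucasAux_zero_add, lucasAux_one_add] using h
  · intro i hi
    exact lucasAux_of_lt (by simpa using hi)

theorem lucasAux_pos (d n : ℕ) : 0 < lucasAux (d + 2) (n + d) := by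
  induction n using Nat.strong_induction_on with
  | _ n ih =>
    match n with
    | 0 => simp [lucasAux_zero_add]
    | 1 => simp [add_comm 1 d, lucasAux_one_add]
    | n + 2 =>
      have h := lucasAux_add_le d n
      have h0 := ih n (by omega)
      have h1 := lucasAux_nonneg d (n + d + 1)
      rw [show n + 2 + d = n + d + 2 by omega]
      linarith

theorem lucasAux_strictMono (d : ℕ) : StrictMono fun n => lucasAux (d + 2) (n + d + 1) :=
  strictMono_nat_of_lt_succ fun n => by
    have h := lucasAux_add_le d n
    have h0 := lucasAux_pos d n
    rw [show n + 1 + d + 1 = n + d + 2 by omega]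
    linarith

theorem le_of_lucasAux_le {d m N : ℕ} (hN : 1 ≤ N)
    (h : lucasAux (d + 2) (m + d) ≤ lucasAux (d + 2) (N + d)) : m ≤ N := by
  by_contra! hlt
  obtain ⟨M, rfl⟩ := Nat.exists_eq_add_of_le' hN
  obtain ⟨c, rfl⟩ := Nat.exists_eq_add_of_le' (show 1 ≤ m by omega)
  have := lucasAux_strictMono d (show M < c by omega)
  simp only [add_right_comm _ d 1] at this
  linarith

theorem nonneg_of_rec {d : ℕ} {D : ℕ → ℤ}
    (hrec : ∀ j, D (j + d + 2) = ∑ i ∈ Finset.range (d + 2), D (j + i))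
    (hlt : ∀ j < d, 0 ≤ D j) (h1 : 0 ≤ D (d + 1)) (h01 : 0 ≤ D d + D (d + 1))
    (j : ℕ) (hj : j ≠ d) : 0 ≤ D j := by
  induction j using Nat.strong_induction_on with
  | _ j ih =>
    rcases Nat.lt_or_ge j d with h | h
    · exact hlt j h
    rcases Nat.lt_or_ge j (d + 2) with h' | h'
    · obtain rfl : j = d + 1 := by omega
      exact h1
    obtain ⟨c, rfl⟩ := Nat.exists_eq_add_of_le' h'
    rw [← add_assoc, hrec]
    rcases Nat.lt_or_ge d c with hc | hc
    · refine Finset.sum_nonneg fun i hi => ih _ ?_ ?_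
      · have := Finset.mem_range.1 hi
        omega
      · omega
    · obtain ⟨e, rfl⟩ := Nat.exists_eq_add_of_le hc
      have hsub : ({e, e + 1} : Finset ℕ) ⊆ Finset.range (c + e + 2) := by
        intro i hi
        simp only [Finset.mem_insert, Finset.mem_singleton] at hi
        rw [Finset.mem_range]
        omega
      refine le_trans ?_ (Finset.sum_le_sum_of_subset_of_nonneg hsub fun i hi hi' => ih _ ?_ ?_)
      · rw [Finset.sum_pair (by omega), ← add_assoc]
        exact h01
      · have := Finset.mem_range.1 hi
        omega
      · simp only [Finset.mem_insert, Finset.mem_singleton] at hi'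
        omega

theorem lucasAux_mul_le (d a b : ℕ) :
    lucasAux (d + 2) (a + d + 1) * lucasAux (d + 2) (b + d + 1) ≤
      lucasAux (d + 2) (a + b + d + 3) := by
  have hb1 := lucasAux_add_le d b
  have hb2 := lucasAux_add_le d (b + 1)
  have hb := lucasAux_nonneg d (b + d)
  have hb' := lucasAux_nonneg d (b + d + 1)
  rw [show b + 1 + d = b + d + 1 by omega] at hb2
  have key := nonneg_of_rec (d := d)
    (D := fun j => lucasAux (d + 2) (j + b + 2) -
      lucasAux (d + 2) j * lucasAux (d + 2) (b + d + 1))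
    (fun j => by
      rw [show j + d + 2 + b + 2 = (j + b + 2) + d + 2 by omega, lucasAux_rec, lucasAux_rec,
        Finset.sum_mul, ← Finset.sum_sub_distrib]
      exact Finset.sum_congr rfl fun i _ => by
        rw [show j + b + 2 + i = j + i + b + 2 by omega])
    (fun j hj => by
      simp only [lucasAux_of_lt hj, zero_mul, sub_zero]
      exact lucasAux_nonneg _ _)
    (by
      simp only [lucasAux_one_add]
      rw [show d + 1 + b + 2 = b + d + 1 + 2 by omega]
      linarith)
    (by
      simp only [lucasAux_one_add, lucasAux_zero_add]
      rw [show d + 1 + b + 2 = b + d + 1 + 2 by omega, show d + b + 2 = b + d + 2 by omega]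
      rw [add_assoc _ 1 1] at hb2
      linarith)
    (a + d + 1) (by omega)
  rw [show a + d + 1 + b + 2 = a + b + d + 3 by omega] at key
  linarith

theorem lucasAux_pow_le (d a x : ℕ) :
    lucasAux (d + 2) (a + d + 1) ^ (x + 1) ≤ lucasAux (d + 2) ((a + 2) * x + a + d + 1) := by
  induction x with
  | zero => simp
  | succ x ih =>
    rw [pow_succ]
    refine (mul_le_mul_of_nonneg_right ih (lucasAux_nonneg d _)).trans
      ((lucasAux_mul_le d _ a).trans_eq ?_)
    congr 1
    ring

theorem lucasAux_add_le_two_pow_mul (d a c : ℕ) :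
    lucasAux (d + 2) (a + c + d + 2) ≤ 2 ^ c * lucasAux (d + 2) (a + d + 2) := by
  induction c with
  | zero => simp
  | succ c ih =>
    have := lucasAux_succ_le_two_mul d (a + c)
    rw [show a + (c + 1) + d + 2 = a + c + d + 3 by omega, pow_succ]
    linarith

theorem lucasAux_eq_three_mul_two_pow {d c : ℕ} (hc : c ≤ d) :
    lucasAux (d + 2) (c + d + 2) = 3 * 2 ^ c := by
  induction c with
  | zero => simp [lucasAux_two_add]
  | succ c ih =>
    have := lucasAux_add_eq_two_mul d c
    rw [lucasAux_of_lt hc, ih (by omega)] at this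
    rw [show c + 1 + d + 2 = c + d + 3 by omega, pow_succ]
    linarith

theorem lucasAux_add_le_mul (d a b : ℕ) :
    lucasAux (d + 2) (a + b + d + 2) ≤
      lucasAux (d + 2) (a + d + 2) * lucasAux (d + 2) (b + d + 1) := by
  induction b using Nat.strong_induction_on with
  | _ b ih =>
    rcases Nat.eq_zero_or_pos b with rfl | hb
    · simp [lucasAux_one_add]
    rcases Nat.lt_or_ge b (d + 2) with h | h
    · obtain ⟨c, rfl⟩ := Nat.exists_eq_add_of_le' hb
      have h1 := lucasAux_add_le_two_pow_mul d a (c + 1)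
      rw [show c + 1 + d + 1 = c + d + 2 by omega,
        lucasAux_eq_three_mul_two_pow (show c ≤ d by omega)]
      have h2 : 0 ≤ 2 ^ c * lucasAux (d + 2) (a + d + 2) :=
        mul_nonneg (by positivity) (lucasAux_nonneg d _)
      rw [pow_succ] at h1
      linarith
    · obtain ⟨c, rfl⟩ := Nat.exists_eq_add_of_le' h
      rw [show a + (c + (d + 2)) + d + 2 = (a + c + d + 2) + d + 2 by omega,
        show c + (d + 2) + d + 1 = (c + d + 1) + d + 2 by omega, lucasAux_rec,
        lucasAux_rec d (c + d + 1), Finset.mul_sum]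
      refine Finset.sum_le_sum fun i hi => ?_
      have := Finset.mem_range.1 hi
      have h1 := ih (c + i) (by omega)
      rwa [show a + (c + i) + d + 2 = a + c + d + 2 + i by omega,
        show c + i + d + 1 = c + d + 1 + i by omega] at h1

theorem lucasAux_le_pow (d a x : ℕ) :
    lucasAux (d + 2) ((a + 1) * x + d + 1) ≤ lucasAux (d + 2) (a + d + 2) ^ x := by
  induction x with
  | zero => simp [lucasAux_one_add]
  | succ x ih =>
    have h := lucasAux_add_le_mul d a ((a + 1) * x)
    rw [show (a + 1) * (x + 1) + d + 1 = a + (a + 1) * x + d + 2 by ring, pow_succ,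
      mul_comm (_ ^ x)]
    exact h.trans (mul_le_mul_of_nonneg_left ih (lucasAux_nonneg d _))

theorem lucasAux_le_two_pow (d m : ℕ) : lucasAux (d + 2) (m + d) ≤ 2 ^ (m + 1) := by
  match m with
  | 0 => simp [lucasAux_zero_add]
  | 1 => simp [add_comm 1 d, lucasAux_one_add]
  | m + 2 =>
    have h := lucasAux_add_le_two_pow_mul d 0 m
    rw [zero_add, zero_add, lucasAux_two_add] at h
    rw [show m + 2 + d = m + d + 2 by omega]
    have : (0 : ℤ) < 2 ^ m := by positivity
    rw [show m + 2 + 1 = m + 3 by omega, pow_add]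
    linarith

theorem genLucas_natCast (d n : ℕ) : genLucas (d + 2) n = lucasAux (d + 2) (n + d) := by
  rw [genLucas, if_neg (by omega), if_pos (by push_cast; omega)]
  congr 1
  push_cast
  omega

theorem genLucas_neg_one (d : ℕ) : genLucas (d + 2) (-1) = -1 ∨ genLucas (d + 2) (-1) = 0 := by
  rw [genLucas]
  split_ifs with h h'
  · exact .inl rfl
  · right
    apply lucasAux_of_lt
    push_cast at h' ⊢
    omega
  · exact .inr rfl

theorem m_bounds (k n m x : ℕ) (hk : 2 ≤ k) (hx : 1 ≤ x)
    (heq : (genLucas k ((n : ℤ) + 1)) ^ x + (genLucas k (n : ℤ)) ^ x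
        - (genLucas k ((n : ℤ) - 1)) ^ x = genLucas k (m : ℤ)) :
    (n : ℤ) * x - 3 < m ∧ (m : ℤ) < ((n : ℤ) + 3) * x + 3 := by
  obtain ⟨d, rfl⟩ := Nat.exists_eq_add_of_le' hk
  obtain ⟨y, rfl⟩ := Nat.exists_eq_add_of_le' hx
  rw [show (n : ℤ) + 1 = ((n + 1 : ℕ) : ℤ) by push_cast; rfl, genLucas_natCast, genLucas_natCast,
    genLucas_natCast] at heq
  rcases n with _ | n
  · refine ⟨by push_cast; nlinarith, ?_⟩
    simp only [Nat.cast_zero, zero_sub, zero_add, add_comm 1 d, lucasAux_one_add,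
      lucasAux_zero_add, one_pow] at heq
    have hneg : -1 ≤ genLucas (d + 2) (-1) ^ (y + 1) := by
      rcases genLucas_neg_one d with h | h <;> rw [h]
      · rcases neg_one_pow_eq_or ℤ (y + 1) with h | h <;> rw [h]
        norm_num
      · simp
    have hpow : (2 : ℤ) ^ y ≤ 3 ^ y := pow_le_pow_left₀ (by norm_num) (by norm_num) y
    have hone : (1 : ℤ) ≤ 2 ^ y := one_le_pow₀ (by norm_num)
    have h := lucasAux_pow_le d 1 (y + 1)
    rw [show 1 + d + 1 = d + 2 by omega, lucasAux_two_add] at h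
    have hle : lucasAux (d + 2) (m + d) ≤ lucasAux (d + 2) (3 * y + 5 + d) := by
      rw [show (1 + 2) * (y + 1) + 1 + d + 1 = 3 * y + 5 + d by ring] at h
      rw [pow_succ, pow_succ] at h
      rw [pow_succ] at heq
      linarith
    have := le_of_lucasAux_le (by omega) hle
    push_cast
    linarith [(by exact_mod_cast this : (m : ℤ) ≤ 3 * y + 5)]
  · rw [show ((n + 1 : ℕ) : ℤ) - 1 = (n : ℤ) by push_cast; ring, genLucas_natCast] at heq
    have h0 := lucasAux_pos d n
    have h1 := lucasAux_pos d (n + 1)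
    have h2 := lucasAux_pos d (n + 1 + 1)
    constructor
    · rcases n with _ | n
      · rcases y with _ | y
        · push_cast; linarith
        simp only [zero_add, show 1 + 1 + d = d + 2 by omega, add_comm 1 d, lucasAux_one_add,
          lucasAux_zero_add, lucasAux_two_add, one_pow] at heq
        have hm := lucasAux_le_two_pow d m
        have hpow : (2 : ℤ) ^ y ≤ 3 ^ y := pow_le_pow_left₀ (by norm_num) (by norm_num) y
        have hone : (1 : ℤ) ≤ 2 ^ y := one_le_pow₀ (by norm_num)
        have hlt : (2 : ℤ) ^ (y + 1 + 1) < 2 ^ (m + 1) := by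
          refine lt_of_lt_of_le ?_ hm
          rw [← heq]
          simp only [pow_succ]
          linarith
        have := (pow_lt_pow_iff_right₀ (by norm_num : (1 : ℤ) < 2)).1 hlt
        push_cast
        linarith [(by exact_mod_cast this : (y : ℤ) + 1 + 1 < m + 1)]
      · have hmono : lucasAux (d + 2) (n + 1 + d) ≤ lucasAux (d + 2) (n + 1 + 1 + d) := by
          have := (lucasAux_strictMono d).monotone (Nat.le_succ n)
          simpa only [Nat.succ_eq_add_one, add_right_comm _ d 1] using this
        have hp := pow_le_pow_left₀ h0.le hmono (y + 1)
        have h := lucasAux_le_pow d (n + 1) (y + 1)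
        have hle : lucasAux (d + 2) ((n + 1 + 1) * (y + 1) + 1 + d) ≤ lucasAux (d + 2) (m + d) := by
          rw [add_right_comm _ 1 d, ← heq]
          rw [show n + 1 + d + 2 = n + 1 + 1 + 1 + d by omega] at h
          linarith
        have hm : (n + 1 + 1) * (y + 1) + 1 ≤ m := by
          rcases Nat.eq_zero_or_pos m with rfl | hm
          · exfalso
            have h3 := lucasAux_strictMono d (show 1 < (n + 1 + 1) * (y + 1) by nlinarith)
            simp only [add_comm 1 d, lucasAux_two_add] at h3
            rw [add_right_comm _ 1 d, zero_add, lucasAux_zero_add] at hle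
            linarith
          · exact le_of_lucasAux_le hm hle
        have hm' : ((n : ℤ) + 1 + 1) * (y + 1) + 1 ≤ m := by exact_mod_cast hm
        push_cast
        linarith
    · have hsum := lucasAux_add_le d (n + 1)
      have hadd := pow_add_pow_le h2.le h1.le (Nat.succ_ne_zero y)
      have hp0 := pow_pos h0 (y + 1)
      have hpow : (lucasAux (d + 2) (n + 1 + 1 + d) + lucasAux (d + 2) (n + 1 + d)) ^ (y + 1) ≤
          lucasAux (d + 2) (n + 2 + d + 1) ^ (y + 1) := by
        refine pow_le_pow_left₀ (by linarith) ?_ _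
        rw [show n + 2 + d + 1 = n + 1 + d + 2 by omega, add_right_comm (n + 1) 1 d]
        linarith
      have h := lucasAux_pow_le d (n + 2) y
      have hle : lucasAux (d + 2) (m + d) ≤
          lucasAux (d + 2) ((n + 2 + 2) * y + (n + 2) + 1 + d) := by
        rw [add_right_comm _ 1 d, ← heq]
        simp only [Nat.succ_eq_add_one] at hadd
        linarith
      have hm := le_of_lucasAux_le (by omega) hle
      have hm' : (m : ℤ) ≤ (n + 2 + 2) * y + (n + 2) + 1 := by exact_mod_cast hm
      push_cast
      linarith
end

section
/- For every integer k ≥ 2, one has 1/2 < f_k(α) ≤ 3/4, where α is the unique real root greater than 1 of x^k − x^{k−1} − ⋯ − x − 1. -/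
/-- `f_k(x) = (x - 1)/(2 + (k + 1)(x - 2))`. -/
noncomputable def fk (k : ℕ) (x : ℝ) : ℝ := (x - 1) / (2 + ((k : ℝ) + 1) * (x - 2))

/-- A root of `x^k - x^(k-1) - ⋯ - 1` satisfies `α^k (2 - α) = 1`. -/
lemma pow_mul_two_sub_eq_one {k : ℕ} {α : ℝ} (hroot : α ^ k = ∑ i ∈ Finset.range k, α ^ i) :
    α ^ k * (2 - α) = 1 := by
  have h := geom_sum_mul α k
  rw [← hroot] at h
  linarith

/-- A root greater than `1` of `x^k - x^(k-1) - ⋯ - 1` with `k ≥ 2` is at least `8/5`. -/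
lemma eight_fifths_le_of_root {k : ℕ} (hk : 2 ≤ k) {α : ℝ} (hα : 1 < α)
    (hroot : α ^ k = ∑ i ∈ Finset.range k, α ^ i) : 8 / 5 ≤ α := by
  obtain ⟨m, rfl⟩ := Nat.exists_eq_add_of_le' hk
  rw [Finset.sum_range_succ, Finset.sum_range_succ] at hroot
  have hsum : 0 ≤ ∑ i ∈ Finset.range m, α ^ i := Finset.sum_nonneg fun i _ => by positivity
  have hm : 0 < α ^ m := by positivity
  have hquad : 0 ≤ α ^ 2 - α - 1 := by
    refine nonneg_of_mul_nonneg_right (?_ : 0 ≤ α ^ m * (α ^ 2 - α - 1)) hm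
    have : α ^ m * (α ^ 2 - α - 1) = α ^ (m + 2) - α ^ (m + 1) - α ^ m := by ring
    linarith
  nlinarith

lemma three_mul_sub_one_le_two_mul_pow {α : ℝ} (hα : 8 / 5 ≤ α) {k : ℕ} (hk : 2 ≤ k) :
    3 * (k : ℝ) - 1 ≤ 2 * α ^ k := by
  induction k, hk using Nat.le_induction with
  | base => push_cast; nlinarith
  | succ m hm ih =>
    have hm' : (2 : ℝ) ≤ m := by exact_mod_cast hm
    have hstep : α ^ m * (8 / 5) ≤ α ^ m * α := by gcongr
    rw [pow_succ]
    push_cast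
    linarith

theorem fk_alpha_bounds (k : ℕ) (hk : 2 ≤ k) (α : ℝ) (hα : 1 < α)
    (hroot : α ^ k = ∑ i ∈ Finset.range k, α ^ i) :
    1 / 2 < fk k α ∧ fk k α ≤ 3 / 4 := by
  have hk' : (2 : ℝ) ≤ k := by exact_mod_cast hk
  have hone := pow_mul_two_sub_eq_one hroot
  have hpow := three_mul_sub_one_le_two_mul_pow (eight_fifths_le_of_root hk hα hroot) hk
  have hε : 0 < 2 - α := pos_of_mul_pos_right (by rw [hone]; exact one_pos) (by positivity)
  have hle : (3 * (k : ℝ) - 1) * (2 - α) ≤ 2 := by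
    have := mul_le_mul_of_nonneg_right hpow hε.le
    linarith
  have hkε : 0 < ((k : ℝ) - 1) * (2 - α) := mul_pos (by linarith) hε
  have hD : 0 < 2 + ((k : ℝ) + 1) * (α - 2) := by linarith
  unfold fk
  rw [lt_div_iff₀ hD, div_le_iff₀ hD]
  constructor <;> linarith
end

section
/- The only solution in integers x ≥ 2 and m ≥ 2 of the equation 3·2^{m−2} = 3^x + 1 − 2^x is (x, m) = (2, 3). -/
theorem even_of_two_pow_modEq_one {x : ℕ} (h : (2 : ℤ) ^ x ≡ 1 [ZMOD 3]) : Even x := by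
  by_contra hodd
  obtain ⟨y, rfl⟩ := Nat.not_even_iff_odd.mp hodd
  have h4 : (4 : ℤ) ^ y ≡ 1 ^ y [ZMOD 3] := Int.ModEq.pow y (by decide)
  rw [pow_succ, pow_mul] at h
  norm_num [Int.ModEq] at h h4
  omega

theorem four_pow_add_five_lt_nine_pow (n : ℕ) : (4 : ℤ) ^ (n + 2) + 5 < 9 ^ (n + 2) := by
  induction n with
  | zero => norm_num
  | succ n ih =>
    have : (0 : ℤ) < 4 ^ (n + 2) := by positivity
    rw [pow_succ 4 (n + 2), pow_succ 9 (n + 2)]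
    linarith

theorem three_mul_two_pow_eq (x m : ℕ) (hx : 2 ≤ x) (hm : 2 ≤ m) :
    (3 * 2 ^ (m - 2) : ℤ) = 3 ^ x + 1 - 2 ^ x ↔ x = 2 ∧ m = 3 := by
  refine ⟨fun h => ?_, by rintro ⟨rfl, rfl⟩; norm_num⟩
  obtain ⟨k, rfl⟩ := Nat.exists_eq_add_of_le' hm
  rw [Nat.add_sub_cancel] at h
  have hx_even : Even x := by
    apply even_of_two_pow_modEq_one
    have h3 : (3 : ℤ) ∣ 3 ^ x := dvd_pow_self 3 (by omega)
    unfold Int.ModEq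
    omega
  obtain ⟨y, rfl⟩ := hx_even.exists_two_nsmul
  rw [smul_eq_mul] at *
  rw [pow_mul, pow_mul] at h
  norm_num at h
  have h9 : (9 : ℤ) ^ y ≡ 1 ^ y [ZMOD 4] := Int.ModEq.pow y (by decide)
  rw [one_pow] at h9
  have h4 : (4 : ℤ) ∣ 4 ^ y := dvd_pow_self 4 (by omega)
  unfold Int.ModEq at h9
  obtain rfl : k = 1 := by
    match k with
    | 0 => norm_num at h; omega
    | 1 => rfl
    | k + 2 => rw [pow_add] at h; omega
  match y with
  | 0 => omega
  | 1 => simp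
  | n + 2 =>
    have := four_pow_add_five_lt_nine_pow n
    norm_num at h
    omega
end

section
/- There are no integers n ≥ 3, x ≥ 2 and m ≥ 2 with (3·2^{n−1})^x + (3·2^{n−2})^x − (3·2^{n−3})^x = 3·2^{m−2}. -/
theorem nine_dvd_three_mul_pow (a : ℤ) {x : ℕ} (hx : 2 ≤ x) : (9 : ℤ) ∣ (3 * a) ^ x :=
  ((by norm_num : (9 : ℤ) = 3 ^ 2) ▸ pow_dvd_pow_of_dvd (dvd_mul_right 3 a) 2).trans
    (pow_dvd_pow _ hx)

theorem not_nine_dvd_three_mul_two_pow (k : ℕ) : ¬ (9 : ℤ) ∣ 3 * 2 ^ k := by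
  intro h
  have h3 : (3 : ℤ) ∣ 2 ^ k := by omega
  have h2 : (3 : ℤ) ∣ 2 := Int.prime_three.dvd_of_dvd_pow h3
  omega

theorem no_three_pow_two_pow_solution (n x m : ℕ) (hn : 3 ≤ n) (hx : 2 ≤ x) (hm : 2 ≤ m) :
    ((3 * 2 ^ (n - 1) : ℤ)) ^ x + ((3 * 2 ^ (n - 2) : ℤ)) ^ x
        - ((3 * 2 ^ (n - 3) : ℤ)) ^ x ≠ 3 * 2 ^ (m - 2) := by
  intro h
  apply not_nine_dvd_three_mul_two_pow (m - 2)
  rw [← h]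
  exact dvd_sub (dvd_add (nine_dvd_three_mul_pow _ hx) (nine_dvd_three_mul_pow _ hx))
    (nine_dvd_three_mul_pow _ hx)
end

section
/- Let (L_n) denote the classical Lucas sequence (L_0 = 2, L_1 = 1, L_n = L_{n−1} + L_{n−2}). The only solutions in integers x ≥ 1 and m ≥ 0 of 2^x + 1 − (−1)^x = L_m are (x, m) = (1, 3) and (x, m) = (2, 3). -/
/-- The classical Lucas sequence: `L_0 = 2`, `L_1 = 1`, `L_n = L_{n-1} + L_{n-2}`. -/
def lucasSeq : ℕ → ℤ
  | 0 => 2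
  | 1 => 1
  | n + 2 => lucasSeq (n + 1) + lucasSeq n

theorem lucasSeq_add_two (n : ℕ) : lucasSeq (n + 2) = lucasSeq (n + 1) + lucasSeq n := rfl

theorem lucasSeq_pos (n : ℕ) : 0 < lucasSeq n := by
  induction n using Nat.twoStepInduction with
  | zero => decide
  | one => decide
  | more n h₀ h₁ => rw [lucasSeq_add_two]; omega

theorem seven_le_lucasSeq (n : ℕ) : 7 ≤ lucasSeq (n + 4) := by
  induction n with
  | zero => decide
  | succ n ih =>
    have := lucasSeq_pos (n + 3)
    have := lucasSeq_add_two (n + 3)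
    simp only [Nat.add_assoc, Nat.reduceAdd] at *
    omega

theorem lucasSeq_eq_four {m : ℕ} (h : lucasSeq m = 4) : m = 3 := by
  by_cases hm : 4 ≤ m
  · obtain ⟨n, rfl⟩ := Nat.exists_eq_add_of_le' hm
    have := seven_le_lucasSeq n
    omega
  · have : m < 4 := by omega
    interval_cases m <;> simp_all [lucasSeq]

theorem lucasSeq_add_twelve_emod_eight (n : ℕ) : lucasSeq (n + 12) % 8 = lucasSeq n % 8 := by
  simp only [lucasSeq]
  omega

theorem lucasSeq_emod_eight (m : ℕ) : lucasSeq m % 8 = lucasSeq (m % 12) % 8 := by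
  induction m using Nat.strong_induction_on with
  | _ m ih =>
    by_cases hm : m < 12
    · rw [Nat.mod_eq_of_lt hm]
    · obtain ⟨n, rfl⟩ := Nat.exists_eq_add_of_le' (Nat.le_of_not_lt hm)
      rw [lucasSeq_add_twelve_emod_eight, ih n (by omega), Nat.add_mod_right]

theorem lucasSeq_emod_eight_ne_zero (m : ℕ) : lucasSeq m % 8 ≠ 0 := by
  rw [lucasSeq_emod_eight]
  have : m % 12 < 12 := Nat.mod_lt _ (by norm_num)
  interval_cases m % 12 <;> decide

theorem lucasSeq_emod_eight_eq_two_iff (m : ℕ) : lucasSeq m % 8 = 2 ↔ 6 ∣ m := by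
  have h6 : 6 ∣ m ↔ 6 ∣ m % 12 := by omega
  rw [lucasSeq_emod_eight, h6]
  have : m % 12 < 12 := Nat.mod_lt _ (by norm_num)
  interval_cases m % 12 <;> decide

theorem lucasSeq_norm (n : ℕ) :
    lucasSeq (n + 1) ^ 2 - lucasSeq n * lucasSeq (n + 1) - lucasSeq n ^ 2 = -5 * (-1) ^ n := by
  induction n with
  | zero => decide
  | succ n ih =>
    rw [lucasSeq_add_two, pow_succ (-1 : ℤ)]
    linear_combination -ih

theorem lucasSeq_two_mul_and_succ (n : ℕ) :
    lucasSeq (2 * n) = lucasSeq n ^ 2 - 2 * (-1) ^ n ∧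
      lucasSeq (2 * n + 1) = lucasSeq n * lucasSeq (n + 1) - (-1) ^ n := by
  induction n with
  | zero => decide
  | succ n ih =>
    obtain ⟨h₀, h₁⟩ := ih
    have h₂ : lucasSeq (2 * (n + 1)) = lucasSeq (n + 1) ^ 2 - 2 * (-1) ^ (n + 1) := by
      rw [Nat.mul_succ, lucasSeq_add_two, pow_succ (-1 : ℤ)]
      linear_combination h₀ + h₁ - lucasSeq_norm n
    refine ⟨h₂, ?_⟩
    have h₃ : lucasSeq (2 * (n + 1) + 1) = lucasSeq (2 * (n + 1)) + lucasSeq (2 * n + 1) := rfl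
    rw [h₃, lucasSeq_add_two, h₂, h₁, pow_succ (-1 : ℤ)]
    ring

theorem lucasSeq_two_mul (n : ℕ) : lucasSeq (2 * n) = lucasSeq n ^ 2 - 2 * (-1) ^ n :=
  (lucasSeq_two_mul_and_succ n).1

theorem eight_dvd_two_pow {x : ℕ} (hx : 3 ≤ x) : (8 : ℤ) ∣ 2 ^ x := by
  simpa using pow_dvd_pow (2 : ℤ) hx

theorem two_pow_ne_sq_of_odd {x : ℕ} (hx : Odd x) (s : ℤ) : (2 : ℤ) ^ x ≠ s ^ 2 := by
  intro h
  obtain ⟨k, rfl⟩ := hx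
  have h4 : ((2 : ℤ) ^ 2) ^ k ≡ 1 ^ k [ZMOD 3] := Int.ModEq.pow k (by decide)
  have h2 : (2 : ℤ) ^ (2 * k + 1) % 3 = 2 := by
    rw [one_pow, ← pow_mul, Int.ModEq] at h4
    omega
  rw [h, pow_two, Int.mul_emod] at h2
  have : s % 3 = 0 ∨ s % 3 = 1 ∨ s % 3 = 2 := by omega
  rcases this with h | h | h <;> simp [h] at h2

theorem two_pow_add_four_ne_sq {s : ℤ} (hs : 0 < s) (hmod : s % 8 = 2) (x : ℕ) :
    (2 : ℤ) ^ x + 4 ≠ s ^ 2 := by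
  intro h
  obtain ⟨t, rfl⟩ : ∃ t, s = 8 * t + 2 := ⟨s / 8, by omega⟩
  have hdvd : 2 * t + 1 ∣ (2 : ℤ) ^ x := ⟨32 * t, by linear_combination h⟩
  have hcop : IsCoprime (2 * t + 1) ((2 : ℤ) ^ x) :=
    IsCoprime.pow_right ⟨1, -t, by ring⟩
  have hunit := hcop.isUnit_of_dvd' dvd_rfl hdvd
  have ht : t = 0 := by
    rcases Int.isUnit_iff.mp hunit with h | h <;> omega
  subst ht
  have : (0 : ℤ) < 2 ^ x := by positivity
  omega

theorem two_pow_add_two_ne_lucasSeq {x : ℕ} (hx : 3 ≤ x) (hodd : Odd x) (m : ℕ) :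
    (2 : ℤ) ^ x + 2 ≠ lucasSeq m := by
  intro h
  have h8 := eight_dvd_two_pow hx
  obtain ⟨k, rfl⟩ := (lucasSeq_emod_eight_eq_two_iff m).mp (by omega)
  rw [show 6 * k = 2 * (3 * k) by ring, lucasSeq_two_mul] at h
  rcases Nat.even_or_odd (3 * k) with hk | hk
  · rw [hk.neg_one_pow] at h
    refine two_pow_add_four_ne_sq (lucasSeq_pos (3 * k))
      ((lucasSeq_emod_eight_eq_two_iff _).mpr ?_) x (by linear_combination h)
    obtain ⟨j, hj⟩ := hk
    omega
  · rw [hk.neg_one_pow] at h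
    exact two_pow_ne_sq_of_odd hodd (lucasSeq (3 * k)) (by linear_combination h)

theorem lucas_eq_two_pow_solutions (x m : ℕ) (hx : 1 ≤ x) :
    (2 : ℤ) ^ x + 1 - (-1) ^ x = lucasSeq m ↔ (x = 1 ∧ m = 3) ∨ (x = 2 ∧ m = 3) := by
  constructor
  · intro h
    by_cases hx3 : 3 ≤ x
    · exfalso
      rcases Nat.even_or_odd x with hpar | hpar
      · rw [hpar.neg_one_pow] at h
        have h8 := eight_dvd_two_pow hx3
        exact lucasSeq_emod_eight_ne_zero m (by omega)
      · rw [hpar.neg_one_pow] at h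
        exact two_pow_add_two_ne_lucasSeq hx3 hpar m (by linear_combination h)
    · have hm : m = 3 := by
        apply lucasSeq_eq_four
        have : x < 3 := by omega
        interval_cases x <;> norm_num at h <;> exact h.symm
      omega
  · rintro (⟨rfl, rfl⟩ | ⟨rfl, rfl⟩) <;> decide
end

section
/- Let (L_n) denote the classical Lucas sequence (L_0 = 2, L_1 = 1, L_n = L_{n−1} + L_{n−2}). There are no integers m ≥ 0 and x ≥ 2 with 4^x + 3^x − 1 = L_m. -/
/-- The Lucas sequence is periodic modulo 45 with period 24. -/
theorem lucasSeq_add_twentyFour_modEq (n : ℕ) : lucasSeq (n + 24) ≡ lucasSeq n [ZMOD 45] := by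
  induction n using Nat.twoStepInduction with
  | zero => decide
  | one => decide
  | more n ih₀ ih₁ => exact ih₁.add ih₀

theorem lucasSeq_modEq_mod (n : ℕ) : lucasSeq n ≡ lucasSeq (n % 24) [ZMOD 45] := by
  induction n using Nat.strong_induction_on with
  | _ n ih =>
    obtain h | h := lt_or_ge n 24
    · rw [Nat.mod_eq_of_lt h]
    · obtain ⟨k, rfl⟩ := Nat.exists_eq_add_of_le' h
      rw [Nat.add_mod_right]
      exact (lucasSeq_add_twentyFour_modEq k).trans (ih k (by lia))

/-- For `2 ≤ x`, the residue of `4 ^ x + 3 ^ x - 1` modulo 45 depends only on `x` modulo 12. -/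
theorem four_pow_add_three_pow_modEq_mod (k : ℕ) :
    (4 : ℤ) ^ (k + 2) + 3 ^ (k + 2) - 1 ≡ 4 ^ (k % 12 + 2) + 3 ^ (k % 12 + 2) - 1 [ZMOD 45] := by
  have four : (4 : ℤ) ^ (12 * (k / 12)) ≡ 1 [ZMOD 45] := by
    rw [pow_mul]
    simpa using (show (4 : ℤ) ^ 12 ≡ 1 [ZMOD 45] by decide).pow (k / 12)
  have three : (3 : ℤ) ^ (12 * (k / 12)) ≡ 1 [ZMOD 5] := by
    rw [pow_mul]
    simpa using (show (3 : ℤ) ^ 12 ≡ 1 [ZMOD 5] by decide).pow (k / 12)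
  have nine := (three.mul_left' (c := 9)).mul_right (3 ^ (k % 12))
  have hk : k + 2 = 12 * (k / 12) + (k % 12 + 2) := by lia
  rw [hk, pow_add 4, pow_add 3]
  refine Int.ModEq.sub_right _ (Int.ModEq.add ?_ ?_)
  · simpa using four.mul_right (4 ^ (k % 12 + 2))
  · convert nine using 1 <;> ring

theorem lucas_ne_four_pow_three_pow (m x : ℕ) (hx : 2 ≤ x) :
    (4 : ℤ) ^ x + 3 ^ x - 1 ≠ lucasSeq m := by
  intro h
  obtain ⟨k, rfl⟩ := Nat.exists_eq_add_of_le' hx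
  have residues : ∀ i < 12, ∀ j < 24,
      ¬ (4 : ℤ) ^ (i + 2) + 3 ^ (i + 2) - 1 ≡ lucasSeq j [ZMOD 45] := by
    decide
  refine residues (k % 12) (Nat.mod_lt _ (by norm_num)) (m % 24) (Nat.mod_lt _ (by norm_num)) ?_
  exact (four_pow_add_three_pow_modEq_mod k).symm.trans (h ▸ lucasSeq_modEq_mod m)
end

section
/- Let k ≥ 2 and let α be the unique real root greater than 1 of x^k − x^{k−1} − ⋯ − x − 1. For all integers m ≥ 1 and x ≥ 2, and for every δ that is either 2, 3, 6, or of the form 3·2^{n−1} with an integer n ≥ 3, one has f_k(α)(2α − 1)α^{m−1} ≠ δ^x. -/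
open Polynomial in
/-- A monic complex polynomial of positive degree with unimodular constant coefficient has a root
in the closed unit disc. -/
theorem exists_root_norm_le_one {p : ℂ[X]} (hp : p.Monic) (hdeg : 0 < p.degree)
    (h0 : ‖p.coeff 0‖ = 1) : ∃ z, p.IsRoot z ∧ ‖z‖ ≤ 1 := by
  by_contra! h
  have hroots : ∀ z ∈ p.roots, 1 < ‖z‖ := fun z hz => h z (isRoot_of_mem_roots hz)
  have hprod : ‖p.roots.prod‖ = 1 := by
    have := (IsAlgClosed.splits p).coeff_zero_eq_prod_roots_of_monic hp
    rw [this] at h0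
    simpa using h0
  obtain ⟨z, hz⟩ := Complex.exists_root hdeg
  have hmem : z ∈ p.roots := (mem_roots hp.ne_zero).2 hz
  obtain ⟨s, hs⟩ := Multiset.exists_cons_of_mem hmem
  have hone : ∀ t : Multiset ℂ, (∀ z ∈ t, 1 < ‖z‖) → 1 ≤ ‖t.prod‖ := by
    intro t
    induction t using Multiset.induction_on with
    | empty => simp
    | cons a t ih =>
      intro ht
      rw [Multiset.prod_cons, norm_mul]
      exact one_le_mul_of_one_le_of_one_le (ht a (Multiset.mem_cons_self a t)).le
        (ih fun z hz => ht z (Multiset.mem_cons_of_mem hz))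
  have hs1 := hone s fun w hw => hroots w (hs ▸ Multiset.mem_cons_of_mem hw)
  have hz1 := hroots z hmem
  rw [hs, Multiset.prod_cons, norm_mul] at hprod
  nlinarith

open Polynomial in
/-- An algebraic integer that is a root of a monic integer polynomial with unit constant
coefficient has a conjugate in the closed unit disc. -/
theorem exists_conjugate_norm_le_one {α : ℝ} {q : ℤ[X]} (hq : q.Monic) (hroot : aeval α q = 0)
    (h0 : IsUnit (q.coeff 0)) :
    ∃ β : ℂ, ‖β‖ ≤ 1 ∧ ∀ r : ℤ[X], aeval α r = 0 → aeval β r = 0 := by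
  have hint : IsIntegral ℤ α := ⟨q, hq, by simpa [aeval_def] using hroot⟩
  have hmonic : (minpoly ℤ α).Monic := minpoly.monic hint
  have hunit : IsUnit ((minpoly ℤ α).coeff 0) := by
    obtain ⟨s, hs⟩ := minpoly.isIntegrallyClosed_dvd hint hroot
    rw [hs, mul_coeff_zero] at h0
    exact isUnit_of_mul_isUnit_left h0
  obtain ⟨β, hβ, hnorm⟩ := exists_root_norm_le_one (hmonic.map (Int.castRingHom ℂ))
    (by rw [hmonic.degree_map]; exact minpoly.degree_pos hint)
    (by rcases Int.isUnit_iff.1 hunit with h | h <;> simp [h])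
  refine ⟨β, hnorm, fun r hr => ?_⟩
  obtain ⟨s, rfl⟩ := minpoly.isIntegrallyClosed_dvd hint hr
  have : aeval β (minpoly ℤ α) = 0 := by
    rw [IsRoot.def, eval_map] at hβ
    simpa [aeval_def] using hβ
  rw [map_mul, this, zero_mul]

/-- On the closed unit disc, `(z - 1)(2z - 1)` is dominated by `2 + (k + 1)(z - 2)`. -/
theorem norm_sub_one_mul_lt {k : ℝ} (hk : 2 ≤ k) {z : ℂ} (hz : ‖z‖ ≤ 1) :
    ‖(z - 1) * (2 * z - 1)‖ < ‖2 + ((k : ℂ) + 1) * (z - 2)‖ := by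
  have h3 : ‖2 * z - 1‖ ≤ 3 := by
    calc ‖2 * z - 1‖ ≤ ‖2 * z‖ + ‖(1 : ℂ)‖ := norm_sub_le _ _
      _ ≤ 3 := by rw [norm_mul, Complex.norm_ofNat, norm_one]; linarith
  have hre : z.re ≤ 1 := (Complex.re_le_norm z).trans hz
  have hlt : 3 * ‖z - 1‖ < ‖2 + ((k : ℂ) + 1) * (z - 2)‖ := by
    refine lt_of_pow_lt_pow_left₀ 2 (norm_nonneg _) ?_
    rw [mul_pow, ← Complex.normSq_eq_norm_sq, ← Complex.normSq_eq_norm_sq,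
      Complex.normSq_apply, Complex.normSq_apply]
    simp only [Complex.sub_re, Complex.sub_im, Complex.add_re, Complex.add_im, Complex.mul_re,
      Complex.mul_im, Complex.ofReal_re, Complex.ofReal_im, Complex.one_re, Complex.one_im,
      Complex.re_ofNat, Complex.im_ofNat]
    have hre' : (3 * (1 - z.re)) ^ 2 < ((k + 1) * (1 - z.re) + (k - 1)) ^ 2 := by
      apply pow_lt_pow_left₀ _ (by linarith) two_ne_zero
      nlinarith
    have him : 9 * z.im ^ 2 ≤ (k + 1) ^ 2 * z.im ^ 2 := by
      gcongr
      nlinarith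
    linarith
  rw [norm_mul]
  nlinarith [norm_nonneg (z - 1)]

open Polynomial in
theorem fk_alpha_ne_delta_pow (k : ℕ) (hk : 2 ≤ k) (α : ℝ) (hα : 1 < α)
    (hroot : α ^ k = ∑ i ∈ Finset.range k, α ^ i)
    (m x : ℕ) (hm : 1 ≤ m) (hx : 2 ≤ x) (δ : ℝ)
    (hδ : δ = 2 ∨ δ = 3 ∨ δ = 6 ∨ ∃ n : ℕ, 3 ≤ n ∧ δ = 3 * 2 ^ (n - 1)) :
    fk k α * (2 * α - 1) * α ^ (m - 1) ≠ δ ^ x := by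
  intro heq
  obtain ⟨d, hd, rfl⟩ : ∃ d : ℕ, 1 ≤ d ∧ δ = d := by
    rcases hδ with h | h | h | ⟨n, -, h⟩
    · exact ⟨2, by norm_num, by simp [h]⟩
    · exact ⟨3, by norm_num, by simp [h]⟩
    · exact ⟨6, by norm_num, by simp [h]⟩
    · exact ⟨3 * 2 ^ (n - 1), Nat.one_le_iff_ne_zero.2 (by positivity), by simp [h]⟩
  have hden : 2 + ((k : ℝ) + 1) * (α - 2) ≠ 0 := by
    intro h
    rw [fk, h, div_zero, zero_mul, zero_mul] at heq
    have : (0 : ℝ) < (d : ℝ) ^ x := by positivity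
    exact this.ne heq
  have hpoly : (α - 1) * (2 * α - 1) * α ^ (m - 1)
      - (d : ℝ) ^ x * (2 + ((k : ℝ) + 1) * (α - 2)) = 0 := by
    rw [← heq, fk]
    field_simp
    ring
  have hdeg : (∑ i ∈ Finset.range k, (X : ℤ[X]) ^ i).degree < k := by
    refine (degree_sum_le _ _).trans_lt ((Finset.sup_lt_iff (WithBot.bot_lt_coe k)).2 ?_)
    intro i hi
    rw [degree_X_pow]
    exact Nat.cast_lt.2 (Finset.mem_range.1 hi)
  obtain ⟨β, hβ, hconj⟩ := exists_conjugate_norm_le_one (α := α)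
    (q := X ^ k - ∑ i ∈ Finset.range k, X ^ i) (monic_X_pow_sub hdeg)
    (by simp [hroot]) (by
      rw [coeff_zero_eq_eval_zero, eval_sub, eval_finsetSum]
      obtain ⟨j, rfl⟩ := Nat.exists_eq_add_of_le' hk
      simp [Finset.sum_range_succ'])
  have hβeq := hconj ((X - 1) * (2 * X - 1) * X ^ (m - 1)
    - (d : ℤ[X]) ^ x * (2 + ((k : ℤ[X]) + 1) * (X - 2))) (by
      simpa only [map_sub, map_mul, map_add, map_pow, aeval_X, map_one, map_ofNat, map_natCast]
        using hpoly)
  simp only [map_sub, map_mul, map_add, map_pow, aeval_X, map_one, map_ofNat, map_natCast,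
    sub_eq_zero] at hβeq
  have hnorm := congrArg norm hβeq
  rw [norm_mul, norm_mul ((d : ℂ) ^ x), norm_pow, norm_pow, Complex.norm_natCast] at hnorm
  have hlt := norm_sub_one_mul_lt (k := k) (by exact_mod_cast hk) hβ
  rw [Complex.ofReal_natCast] at hlt
  have hd1 : (1 : ℝ) ≤ (d : ℝ) ^ x := one_le_pow₀ (by exact_mod_cast hd)
  have hpow : ‖β‖ ^ (m - 1) ≤ 1 := pow_le_one₀ (norm_nonneg _) hβ
  have h1 := mul_le_of_le_one_right (norm_nonneg ((β - 1) * (2 * β - 1))) hpow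
  have h2 := le_mul_of_one_le_left (norm_nonneg (2 + ((k : ℂ) + 1) * (β - 2))) hd1
  linarith
end

section
/- Let k ≥ 2 and let α be the unique real root greater than 1 of x^k − x^{k−1} − ⋯ − x − 1. For all integers x ≥ 2, n ≥ 4 and m, one has ((2α − 1) f_k(α))^{x−1} · α^{(n−1)x−(m−1)} · (1 + α^{−x} − α^{−2x}) ≠ 1. -/
open Polynomial

/-- The characteristic polynomial `X ^ k - X ^ (k - 1) - ⋯ - X - 1` of the `k`-bonacci recurrence. -/
noncomputable def bonacciPoly (k : ℕ) : ℤ[X] := X ^ k - ∑ i ∈ Finset.range k, X ^ i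

theorem degree_sum_range_X_pow_lt (k : ℕ) :
    (∑ i ∈ Finset.range k, (X : ℤ[X]) ^ i).degree < k := by
  rw [← mem_degreeLT]
  refine Submodule.sum_mem _ fun i hi => ?_
  rw [mem_degreeLT, degree_X_pow]
  exact_mod_cast Finset.mem_range.1 hi

theorem bonacciPoly_monic (k : ℕ) : (bonacciPoly k).Monic :=
  monic_X_pow_sub (degree_sum_range_X_pow_lt k)

theorem bonacciPoly_natDegree (k : ℕ) : (bonacciPoly k).natDegree = k := by
  refine natDegree_eq_of_degree_eq_some ?_
  rw [bonacciPoly, degree_sub_eq_left_of_degree_lt] <;> rw [degree_X_pow]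
  exact degree_sum_range_X_pow_lt k

theorem aeval_bonacciPoly {A : Type*} [CommRing A] (k : ℕ) (z : A) :
    aeval z (bonacciPoly k) = z ^ k - ∑ i ∈ Finset.range k, z ^ i := by
  simp [bonacciPoly]

theorem sub_one_mul_aeval_bonacciPoly {A : Type*} [CommRing A] (k : ℕ) (z : A) :
    (z - 1) * aeval z (bonacciPoly k) = z ^ k * (z - 2) + 1 := by
  rw [aeval_bonacciPoly, mul_sub, mul_geom_sum]
  ring

theorem pow_mul_geom_sum_lt {a b : ℝ} {k : ℕ} (hk : k ≠ 0) (ha : 0 < a) (hab : a < b) :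
    a ^ k * ∑ i ∈ Finset.range k, b ^ i < b ^ k * ∑ i ∈ Finset.range k, a ^ i := by
  rw [Finset.mul_sum, Finset.mul_sum]
  refine Finset.sum_lt_sum_of_nonempty (by simpa using hk) fun i hi => ?_
  obtain ⟨j, rfl⟩ := Nat.exists_eq_add_of_lt (Finset.mem_range.1 hi)
  have h : a ^ (j + 1) < b ^ (j + 1) := pow_lt_pow_left₀ hab ha.le (by simp)
  have hp : 0 < a ^ i * b ^ i := mul_pos (pow_pos ha _) (pow_pos (ha.trans hab) _)
  calc a ^ (i + j + 1) * b ^ i = a ^ i * b ^ i * a ^ (j + 1) := by ring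
    _ < a ^ i * b ^ i * b ^ (j + 1) := by gcongr
    _ = b ^ (i + j + 1) * a ^ i := by ring

/-- Every conjugate of the dominant root lies strictly inside the unit circle. -/
theorem bonacciPoly_root_eq_or_norm_lt_one {k : ℕ} (hk : 2 ≤ k) {α : ℝ} (hα : 1 < α)
    (hroot : α ^ k = ∑ i ∈ Finset.range k, α ^ i) {z : ℂ} (hz : aeval z (bonacciPoly k) = 0) :
    z = α ∨ ‖z‖ < 1 := by
  have hzk : z ^ k * (2 - z) = 1 := by
    have := sub_one_mul_aeval_bonacciPoly k z
    rw [hz] at this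
    linear_combination this
  have hαk : α ^ k * (2 - α) = 1 := by
    have := sub_one_mul_aeval_bonacciPoly k α
    rw [aeval_bonacciPoly, hroot, sub_self] at this
    rw [hroot]
    linear_combination this
  have hnorm : ‖z‖ ^ k * ‖2 - z‖ = 1 := by rw [← norm_pow, ← norm_mul, hzk, norm_one]
  have hnorm_sq : ‖2 - z‖ ^ 2 = 4 - 4 * z.re + ‖z‖ ^ 2 := by
    rw [Complex.sq_norm, Complex.sq_norm, Complex.normSq_apply, Complex.normSq_apply]
    simp
    ring
  have eq_of_re : z.re = ‖z‖ → z = (‖z‖ : ℂ) := fun h =>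
    Complex.ext (by simpa using h) (by
      have := Complex.abs_re_eq_norm.1 (by rw [h, abs_norm])
      simpa using this)
  have h2 : 2 - ‖z‖ ≤ ‖2 - z‖ := by simpa using norm_sub_norm_le (2 : ℂ) z
  rcases lt_trichotomy ‖z‖ 1 with h1 | h1 | h1
  · exact Or.inr h1
  · have h3 : ‖2 - z‖ = 1 := by simpa [h1] using hnorm
    have h4 : z = 1 := by
      have := eq_of_re (by rw [h3, h1] at hnorm_sq; linarith)
      simpa [h1] using this
    rw [h4, aeval_bonacciPoly] at hz
    simp only [one_pow, Finset.sum_const, Finset.card_range, nsmul_eq_mul, mul_one] at hz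
    have : k = 1 := by exact_mod_cast (sub_eq_zero.1 hz).symm
    omega
  · left
    have hpos : 0 < ‖z‖ := by linarith
    rcases lt_trichotomy ‖z‖ α with h3 | h3 | h3
    · have h4 := pow_mul_geom_sum_lt (k := k) (by omega) hpos h3
      rw [← hroot, mul_comm, mul_lt_mul_iff_right₀ (by positivity)] at h4
      have h5 := sub_one_mul_aeval_bonacciPoly k ‖z‖
      rw [aeval_bonacciPoly] at h5
      have h6 : ‖z‖ ^ k * (2 - ‖z‖) ≤ 1 := by
        rw [← hnorm]; gcongr
      nlinarith
    · have h4 : ‖2 - z‖ = 2 - α := by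
        rw [h3, ← hαk] at hnorm
        exact mul_left_cancel₀ (by positivity) hnorm
      have := eq_of_re (by rw [h4, h3] at hnorm_sq; linarith)
      rwa [h3] at this
    · have h4 := pow_mul_geom_sum_lt (k := k) (by omega) (by linarith) h3
      rw [← hroot, mul_comm, mul_lt_mul_iff_left₀ (by positivity)] at h4
      have h5 : ‖z‖ ^ k ≤ ∑ i ∈ Finset.range k, ‖z‖ ^ i := by
        rw [aeval_bonacciPoly, sub_eq_zero] at hz
        rw [← norm_pow, hz]
        exact (norm_sum_le _ _).trans_eq (by simp)
      linarith

theorem aeval_derivative_bonacciPoly_ne_zero {k : ℕ} (hk : k ≠ 0) {α : ℝ} (hα : 0 < α)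
    (hroot : α ^ k = ∑ i ∈ Finset.range k, α ^ i) :
    aeval α (derivative (bonacciPoly k)) ≠ 0 := by
  have h : α * aeval α (derivative (bonacciPoly k))
      = ∑ i ∈ Finset.range k, ((k : ℝ) - i) * α ^ i := by
    have hX (i : ℕ) : α * ((i : ℝ) * α ^ (i - 1)) = i * α ^ i := by
      cases i with
      | zero => simp
      | succ i => simp [pow_succ]; ring
    simp only [bonacciPoly, derivative_X_pow, map_sub, map_sum,
      map_mul, map_pow, aeval_X, aeval_C, mul_sub, Finset.mul_sum, sub_mul, Finset.sum_sub_distrib]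
    simp [hX]
    rw [← Finset.mul_sum, hroot]
  have hpos : 0 < ∑ i ∈ Finset.range k, ((k : ℝ) - i) * α ^ i := by
    refine Finset.sum_pos (fun i hi => ?_) (by simpa using hk)
    have : (i : ℝ) < k := by exact_mod_cast Finset.mem_range.1 hi
    exact mul_pos (by linarith) (by positivity)
  intro h0
  rw [h0, mul_zero] at h
  linarith

theorem Multiset.norm_prod_map_le_pow_card {ι : Type*} (s : Multiset ι) (f : ι → ℂ) {c : ℝ}
    (hc : 0 ≤ c) (h : ∀ i ∈ s, ‖f i‖ ≤ c) : ‖(s.map f).prod‖ ≤ c ^ s.card := by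
  induction s using Multiset.induction with
  | empty => simp
  | cons a s ih =>
    rw [Multiset.map_cons, Multiset.prod_cons, norm_mul, Multiset.card_cons, pow_succ']
    exact mul_le_mul (h a (Multiset.mem_cons_self a s))
      (ih fun i hi => h i (Multiset.mem_cons_of_mem hi)) (norm_nonneg _) hc

/-- A monic integer polynomial with nonzero constant term cannot have all its complex roots in the
open unit disc unless it is constant. -/
theorem Polynomial.Monic.eq_one_of_norm_roots_lt_one {p : ℤ[X]} (hp : p.Monic)
    (h0 : p.coeff 0 ≠ 0) (h : ∀ z ∈ p.aroots ℂ, ‖z‖ < 1) : p = 1 := by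
  by_contra hne
  have hcard : (p.aroots ℂ).card = p.natDegree := by
    rw [← (IsAlgClosed.splits (p.map (algebraMap ℤ ℂ))).natDegree_eq_card_roots,
      hp.natDegree_map]
  have hroots : p.aroots ℂ ≠ 0 := fun h => hne <| hp.natDegree_eq_zero.1 (by rw [← hcard, h]; rfl)
  have hprod : ((p.coeff 0 : ℤ) : ℂ) = ((p.aroots ℂ).map (0 - ·)).prod := by
    rw [← (IsAlgClosed.splits _).aeval_eq_prod_aroots_of_monic hp, ← coeff_zero_eq_aeval_zero']
    simp
  have hlt : ‖((p.coeff 0 : ℤ) : ℂ)‖ < 1 := by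
    obtain ⟨z, hz⟩ := Multiset.exists_mem_of_ne_zero hroots
    obtain ⟨t, ht⟩ := Multiset.exists_cons_of_mem hz
    rw [hprod, ht, Multiset.map_cons, Multiset.prod_cons, norm_mul, zero_sub, norm_neg]
    have hle := Multiset.norm_prod_map_le_pow_card t (fun w : ℂ => 0 - w) zero_le_one fun w hw => by
      rw [zero_sub, norm_neg]
      exact (h w (ht ▸ Multiset.mem_cons_of_mem hw)).le
    rw [one_pow] at hle
    exact (mul_le_of_le_one_right (norm_nonneg z) hle).trans_lt (h z hz)
  have : (1 : ℝ) ≤ ‖((p.coeff 0 : ℤ) : ℂ)‖ := by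
    rw [Complex.norm_intCast]
    exact_mod_cast Int.one_le_abs h0
  linarith

theorem minpoly_eq_bonacciPoly {k : ℕ} (hk : 2 ≤ k) {α : ℝ} (hα : 1 < α)
    (hroot : α ^ k = ∑ i ∈ Finset.range k, α ^ i) : minpoly ℤ α = bonacciPoly k := by
  have hα0 : aeval α (bonacciPoly k) = 0 := by rw [aeval_bonacciPoly, hroot, sub_self]
  have hint : IsIntegral ℤ α := ⟨_, bonacciPoly_monic k, hα0⟩
  obtain ⟨h, hh⟩ := minpoly.isIntegrallyClosed_dvd hint hα0
  have hm : h.Monic := (minpoly.monic hint).of_mul_monic_left (hh ▸ bonacciPoly_monic k)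
  have hcoeff : h.coeff 0 ≠ 0 := fun h0 => by
    have h1 := sub_one_mul_aeval_bonacciPoly k (0 : ℤ)
    rw [hh, map_mul, ← coeff_zero_eq_aeval_zero h, h0, mul_zero, mul_zero,
      zero_pow (by omega)] at h1
    simp at h1
  suffices h = 1 by rw [hh, this, mul_one]
  refine hm.eq_one_of_norm_roots_lt_one hcoeff fun z hz => ?_
  have hz : aeval z h = 0 := (mem_aroots.1 hz).2
  refine (bonacciPoly_root_eq_or_norm_lt_one hk hα hroot
    (by rw [hh, map_mul, hz, mul_zero])).resolve_left ?_
  rintro rfl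
  have hz' : aeval α h = 0 := by
    have : (algebraMap ℝ ℂ) (aeval α h) = 0 := by rw [← aeval_algebraMap_apply]; exact hz
    simpa using this
  refine aeval_derivative_bonacciPoly_ne_zero (by omega) (by linarith) hroot ?_
  rw [hh, derivative_mul, map_add, map_mul, map_mul, hz', minpoly.aeval]
  simp

/-- The product of the values of `q` at the complex roots of `p`, in absolute value; for `p` the
minimal polynomial of an algebraic integer `α` this is the absolute norm of `q(α)`. -/
noncomputable def rootNorm (p q : ℤ[X]) : ℝ := ‖((p.aroots ℂ).map fun z => aeval z q).prod‖

theorem rootNorm_mul (p q r : ℤ[X]) : rootNorm p (q * r) = rootNorm p q * rootNorm p r := by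
  simp [rootNorm, Multiset.prod_map_mul]

theorem rootNorm_pow (p q : ℤ[X]) (n : ℕ) : rootNorm p (q ^ n) = rootNorm p q ^ n := by
  simp [rootNorm, Multiset.prod_map_pow]

theorem Polynomial.Monic.rootNorm_eq_natAbs_resultant {p : ℤ[X]} (hp : p.Monic) (q : ℤ[X]) :
    rootNorm p q = (resultant p q).natAbs := by
  have h := resultant_eq_prod_eval (p.map (algebraMap ℤ ℂ)) (q.map (algebraMap ℤ ℂ)) q.natDegree
    natDegree_map_le (IsAlgClosed.splits _)
  rw [hp.natDegree_map, resultant_map_map, (hp.map _).leadingCoeff, one_pow, one_mul] at h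
  simp only [eval_map_algebraMap] at h
  rw [rootNorm, aroots_def, ← h]
  simp [Nat.cast_natAbs]

theorem rootNorm_congr {k : ℕ} (hk : 2 ≤ k) {α : ℝ} (hα : 1 < α)
    (hroot : α ^ k = ∑ i ∈ Finset.range k, α ^ i) {q r : ℤ[X]} (h : aeval α q = aeval α r) :
    rootNorm (bonacciPoly k) q = rootNorm (bonacciPoly k) r := by
  have hα0 : aeval α (bonacciPoly k) = 0 := by rw [aeval_bonacciPoly, hroot, sub_self]
  have hdvd : bonacciPoly k ∣ q - r := by
    rw [← minpoly_eq_bonacciPoly hk hα hroot]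
    exact minpoly.isIntegrallyClosed_dvd ⟨_, bonacciPoly_monic k, hα0⟩ (by rw [map_sub, h, sub_self])
  rw [rootNorm, rootNorm, Multiset.map_congr rfl fun z hz => ?_]
  obtain ⟨s, hs⟩ := hdvd
  rw [← sub_eq_zero, ← map_sub, hs, map_mul, (mem_aroots.1 hz).2, zero_mul]

theorem card_aroots_bonacciPoly (k : ℕ) : ((bonacciPoly k).aroots ℂ).card = k := by
  rw [← (IsAlgClosed.splits ((bonacciPoly k).map (algebraMap ℤ ℂ))).natDegree_eq_card_roots,
    (bonacciPoly_monic k).natDegree_map, bonacciPoly_natDegree]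

theorem rootNorm_bonacciPoly_linear (k : ℕ) {a : ℤ} (ha : a ≠ 0) (b : ℤ) :
    rootNorm (bonacciPoly k) (C a * X - C b)
      = ‖(a : ℂ) ^ k * aeval ((b : ℂ) / a) (bonacciPoly k)‖ := by
  have ha' : (a : ℂ) ≠ 0 := by exact_mod_cast ha
  rw [rootNorm, (IsAlgClosed.splits _).aeval_eq_prod_aroots_of_monic (bonacciPoly_monic k)]
  have h (z : ℂ) : aeval z (C a * X - C b) = -(a : ℂ) * ((b : ℂ) / a - z) := by
    simp
    field_simp
    ring
  simp only [h, Multiset.prod_map_mul, Multiset.map_const', Multiset.prod_replicate,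
    card_aroots_bonacciPoly, norm_mul, norm_pow, norm_neg]

theorem rootNorm_bonacciPoly_linear_mul (k : ℕ) {a : ℤ} (ha : a ≠ 0) (b : ℤ) :
    rootNorm (bonacciPoly k) (C a * X - C b) * |(b - a : ℤ)|
      = |b ^ k * (b - 2 * a) + a ^ (k + 1)| := by
  have ha' : (a : ℂ) ≠ 0 := by exact_mod_cast ha
  have h := sub_one_mul_aeval_bonacciPoly k ((b : ℂ) / a)
  have h' : (a : ℂ) ^ k * aeval ((b : ℂ) / a) (bonacciPoly k) * ((b - a : ℤ) : ℂ)
      = ((b ^ k * (b - 2 * a) + a ^ (k + 1) : ℤ) : ℂ) := by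
    calc (a : ℂ) ^ k * aeval ((b : ℂ) / a) (bonacciPoly k) * ((b - a : ℤ) : ℂ)
        = a ^ (k + 1) * (((b : ℂ) / a - 1) * aeval ((b : ℂ) / a) (bonacciPoly k)) := by
          push_cast; field_simp; ring
      _ = _ := by rw [h, div_pow]; push_cast; field_simp; ring
  rw [rootNorm_bonacciPoly_linear k ha, Int.cast_abs, Int.cast_abs,
    ← Complex.norm_intCast, ← Complex.norm_intCast, ← norm_mul, h']

theorem rootNorm_bonacciPoly_X {k : ℕ} (hk : k ≠ 0) : rootNorm (bonacciPoly k) X = 1 := by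
  simpa [hk] using rootNorm_bonacciPoly_linear_mul k one_ne_zero 0

theorem rootNorm_bonacciPoly_X_sub_one {k : ℕ} (hk : 1 ≤ k) :
    rootNorm (bonacciPoly k) (X - 1) = (k : ℝ) - 1 := by
  have h := rootNorm_bonacciPoly_linear k one_ne_zero 1
  simp only [map_one, one_mul, aeval_bonacciPoly, Int.cast_one, div_one, one_pow,
    Finset.sum_const, Finset.card_range, nsmul_eq_mul, mul_one] at h
  rw [h, norm_sub_rev, ← Nat.cast_one, ← Nat.cast_sub hk, Complex.norm_natCast, Nat.cast_sub hk,
    Nat.cast_one]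

theorem rootNorm_bonacciPoly_two_mul_X_sub_one {k : ℕ} (hk : 1 ≤ k) :
    rootNorm (bonacciPoly k) (2 * X - 1) = (2 : ℝ) ^ (k + 1) - 3 := by
  have h := rootNorm_bonacciPoly_linear_mul k two_ne_zero 1
  have h2 : (2 : ℝ) ^ 2 ≤ 2 ^ (k + 1) := pow_le_pow_right₀ (by norm_num) (by omega)
  norm_num at h
  rw [h, abs_of_nonneg] <;> linarith

theorem rootNorm_bonacciPoly_denominator (k : ℕ) (hk : 1 ≤ k) :
    rootNorm (bonacciPoly k) (C ((k : ℤ) + 1) * X - C (2 * (k : ℤ))) * ((k : ℝ) - 1)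
      = |(2 : ℝ) ^ (k + 1) * k ^ k - (k + 1) ^ (k + 1)| := by
  have h := rootNorm_bonacciPoly_linear_mul k (a := (k : ℤ) + 1) (by omega) (2 * k)
  have hk' : (1 : ℝ) ≤ k := by exact_mod_cast hk
  push_cast at h
  rw [show 2 * (k : ℝ) - (k + 1) = k - 1 by ring, abs_of_nonneg (sub_nonneg.2 hk')] at h
  rw [h, ← abs_neg]
  congr 1
  ring

/-- The dominant root contributes `|q(α)|` to the norm, and every other root at most `c`. -/
theorem rootNorm_bonacciPoly_le {k : ℕ} (hk : 2 ≤ k) {α : ℝ} (hα : 1 < α)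
    (hroot : α ^ k = ∑ i ∈ Finset.range k, α ^ i) (q : ℤ[X]) {c : ℝ} (hc : 0 ≤ c)
    (h : ∀ z : ℂ, ‖z‖ < 1 → ‖aeval z q‖ ≤ c) :
    rootNorm (bonacciPoly k) q ≤ |aeval α q| * c ^ (k - 1) := by
  have hne : (bonacciPoly k).map (algebraMap ℤ ℂ) ≠ 0 := ((bonacciPoly_monic k).map _).ne_zero
  have haeval (p : ℤ[X]) : aeval (α : ℂ) p = ((aeval α p : ℝ) : ℂ) :=
    aeval_algebraMap_apply ℂ α p
  have hα0 : aeval (α : ℂ) (bonacciPoly k) = 0 := by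
    rw [haeval, aeval_bonacciPoly, hroot, sub_self, Complex.ofReal_zero]
  have hmem : (α : ℂ) ∈ (bonacciPoly k).aroots ℂ :=
    mem_aroots.2 ⟨(bonacciPoly_monic k).ne_zero, hα0⟩
  obtain ⟨t, ht⟩ := Multiset.exists_cons_of_mem hmem
  have hnot : (α : ℂ) ∉ t := fun hmem' => by
    have hcount : 1 < ((bonacciPoly k).map (algebraMap ℤ ℂ)).rootMultiplicity (α : ℂ) := by
      rw [← count_roots, ← aroots_def, ht, Multiset.count_cons_self]
      have := Multiset.count_pos.2 hmem'
      omega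
    have := ((one_lt_rootMultiplicity_iff_isRoot hne).1 hcount).2
    rw [derivative_map, IsRoot.def, eval_map_algebraMap, haeval, Complex.ofReal_eq_zero] at this
    exact aeval_derivative_bonacciPoly_ne_zero (by omega) (by linarith) hroot this
  have hcard : t.card = k - 1 := by
    have := card_aroots_bonacciPoly k
    rw [ht, Multiset.card_cons] at this
    omega
  rw [rootNorm, ht, Multiset.map_cons, Multiset.prod_cons, norm_mul, haeval, Complex.norm_real,
    Real.norm_eq_abs, ← hcard]
  refine mul_le_mul_of_nonneg_left (Multiset.norm_prod_map_le_pow_card t _ hc fun z hz => h z ?_)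
    (abs_nonneg _)
  refine (bonacciPoly_root_eq_or_norm_lt_one hk hα hroot
    (mem_aroots.1 (ht ▸ Multiset.mem_cons_of_mem hz)).2).resolve_left ?_
  rintro rfl
  exact hnot hz

theorem ten_mul_succ_pow_le {k : ℕ} (hk : 7 ≤ k) :
    10 * (k + 1) ^ (k + 1) ≤ 2 ^ (k + 1) * k ^ k := by
  induction k, hk using Nat.le_induction with
  | base => norm_num
  | succ k hk ih =>
    have h1 : ((k + 2) * k) ^ k ≤ ((k + 1) ^ 2) ^ k := by gcongr; nlinarith
    have h2 : (k + 2) ^ 2 ≤ 2 * (k + 1) ^ 2 := by nlinarith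
    have hpos : 0 < k ^ k := by positivity
    refine le_of_mul_le_mul_right ?_ hpos
    calc 10 * (k + 1 + 1) ^ (k + 1 + 1) * k ^ k = 10 * ((k + 2) * k) ^ k * (k + 2) ^ 2 := by
          rw [mul_pow]; ring
      _ ≤ 10 * ((k + 1) ^ 2) ^ k * (2 * (k + 1) ^ 2) := by gcongr
      _ = 2 * (k + 1) ^ (k + 1) * (10 * (k + 1) ^ (k + 1)) := by rw [← pow_mul]; ring
      _ ≤ 2 * (k + 1) ^ (k + 1) * (2 ^ (k + 1) * k ^ k) := by gcongr
      _ = _ := by ring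

theorem two_hundred_mul_three_pow_mul_sq_le {k : ℕ} (hk : 7 ≤ k) :
    200 * 3 ^ (k - 1) * (k - 1) ^ 2 ≤ 9 * k ^ k := by
  obtain ⟨j, rfl⟩ := Nat.exists_eq_add_of_le' (show 1 ≤ k by omega)
  rw [Nat.add_sub_cancel]
  have hj : 6 ≤ j := by omega
  clear hk
  induction j, hj using Nat.le_induction with
  | base => norm_num
  | succ j hj ih =>
    have h1 : (j + 1) ^ (j + 1) ≤ (j + 1 + 1) ^ (j + 1) := Nat.pow_le_pow_left (by omega) _
    calc 200 * 3 ^ (j + 1) * (j + 1) ^ 2 = 200 * 3 ^ j * (3 * (j + 1) ^ 2) := by ring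
      _ ≤ 200 * 3 ^ j * ((j + 1 + 1) * j ^ 2) := Nat.mul_le_mul_left _ (by nlinarith)
      _ = (200 * 3 ^ j * j ^ 2) * (j + 1 + 1) := by ring
      _ ≤ 9 * (j + 1) ^ (j + 1) * (j + 1 + 1) := by gcongr
      _ ≤ 9 * (j + 1 + 1) ^ (j + 1) * (j + 1 + 1) := by gcongr
      _ = _ := by ring

/-- The numerical inequality that rules out `k ≥ 7`. -/
theorem twenty_mul_three_pow_mul_le {k : ℕ} (hk : 7 ≤ k) :
    20 * 3 ^ (k - 1) * (((2 : ℝ) ^ (k + 1) - 3) * (k - 1) ^ 2)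
      ≤ 2 ^ (k + 1) * k ^ k - (k + 1) ^ (k + 1) := by
  have h1 : (10 : ℝ) * (k + 1) ^ (k + 1) ≤ 2 ^ (k + 1) * k ^ k := by
    exact_mod_cast ten_mul_succ_pow_le hk
  have h2 : (200 : ℝ) * 3 ^ (k - 1) * (k - 1) ^ 2 ≤ 9 * k ^ k := by
    have hcast : (k : ℝ) - 1 = ((k - 1 : ℕ) : ℝ) := by rw [Nat.cast_pred (by omega)]
    rw [hcast]
    exact_mod_cast two_hundred_mul_three_pow_mul_sq_le hk
  have h3 : 20 * 3 ^ (k - 1) * (((2 : ℝ) ^ (k + 1) - 3) * (k - 1) ^ 2)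
      ≤ 20 * 3 ^ (k - 1) * ((2 : ℝ) ^ (k + 1) * (k - 1) ^ 2) := by
    gcongr
    linarith
  have h4 := mul_le_mul_of_nonneg_left h2 (show (0 : ℝ) ≤ 2 ^ (k + 1) by positivity)
  linarith

/-- For `k = 2` the left-hand side lies strictly between two consecutive powers of `α`. -/
theorem zpow_mul_one_add_ne_one {α : ℝ} (hα : 1 < α) (hroot : α ^ 2 = α + 1) {x : ℕ} (hx : 2 ≤ x)
    (e : ℤ) : α ^ e * (1 + α ^ (-(x : ℤ)) - α ^ (-(2 * (x : ℤ)))) ≠ 1 := by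
  have hα0 : 0 < α := by linarith
  set t := α ^ (-(x : ℤ)) with ht
  have h2 : α ^ (-(2 * (x : ℤ))) = t ^ 2 := by
    rw [ht, ← zpow_natCast, ← zpow_mul]; congr 1; push_cast; ring
  have htpos : 0 < t := zpow_pos hα0 _
  have htle : t * α ^ 2 ≤ 1 := by
    rw [ht, ← zpow_natCast, ← zpow_add₀ hα0.ne']
    exact zpow_le_one_of_nonpos₀ hα.le (by push_cast; omega)
  have ht1 : t < 1 := by nlinarith
  rw [h2]
  intro h
  have hlow : 1 < 1 + t - t ^ 2 := by nlinarith
  have hup : 1 + t - t ^ 2 < α := by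
    have hα2 : 0 < α ^ 2 := by positivity
    nlinarith [mul_pos hα0 htpos, mul_pos htpos htpos]
  have hpos : 0 < α ^ e := zpow_pos hα0 _
  have he1 : α ^ e < 1 := by nlinarith
  have he2 : α ^ (-1 : ℤ) < α ^ e := by
    rw [zpow_neg_one, inv_lt_iff_one_lt_mul₀ hα0]
    nlinarith
  rw [zpow_lt_one_iff_right₀ hα] at he1
  rw [zpow_lt_zpow_iff_right₀ hα] at he2
  omega

/-- Taking norms in the equation gives an identity for the norm of `α ^ (2 * x) + α ^ x - 1`. -/
theorem rootNorm_eq_of_gamma_five_eq_one {k : ℕ} (hk : 2 ≤ k) {α : ℝ} (hα : 1 < α)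
    (hroot : α ^ k = ∑ i ∈ Finset.range k, α ^ i) {x y : ℕ} (hy : y ≠ 0) {e : ℤ}
    (h : ((2 * α - 1) * fk k α) ^ y * α ^ e
      * (1 + α ^ (-(x : ℤ)) - α ^ (-(2 * (x : ℤ)))) = 1) :
    (((2 : ℝ) ^ (k + 1) - 3) * (k - 1) ^ 2) ^ y
        * rootNorm (bonacciPoly k) (X ^ (2 * x) + X ^ x - 1)
      = |(2 : ℝ) ^ (k + 1) * k ^ k - (k + 1) ^ (k + 1)| ^ y := by
  have hα0 : 0 < α := by linarith
  obtain ⟨a, b, rfl⟩ : ∃ a b : ℕ, e = a - b := ⟨e.toNat, (-e).toNat, by omega⟩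
  have hd : 2 + ((k : ℝ) + 1) * (α - 2) ≠ 0 := fun hd => by
    rw [fk, hd, div_zero, mul_zero, zero_pow hy] at h
    simp at h
  have hreal : aeval α (((2 * X - 1) * (X - 1)) ^ y * X ^ a * (X ^ (2 * x) + X ^ x - 1) : ℤ[X])
      = aeval α ((C ((k : ℤ) + 1) * X - C (2 * (k : ℤ))) ^ y * X ^ b * X ^ (2 * x) : ℤ[X]) := by
    simp only [map_mul, map_pow, map_sub, map_add, map_one, aeval_X, map_natCast, map_ofNat]
    rw [fk, ← mul_div_assoc, div_pow, zpow_sub₀ hα0.ne', zpow_neg, zpow_neg,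
      show (2 * (x : ℤ)) = ((2 * x : ℕ) : ℤ) by push_cast; ring] at h
    simp only [zpow_natCast] at h
    rw [show ((k : ℝ) + 1) * α - 2 * k = 2 + ((k : ℝ) + 1) * (α - 2) by ring]
    have h2 : α ^ (2 * x) = α ^ x * α ^ x := by rw [← pow_add]; congr 1; omega
    rw [h2] at h ⊢
    field_simp at h
    linear_combination h
  have hnorm := rootNorm_congr hk hα hroot hreal
  simp only [rootNorm_mul, rootNorm_pow, rootNorm_bonacciPoly_X (show k ≠ 0 by omega), one_pow, mul_one,
    rootNorm_bonacciPoly_X_sub_one (show 1 ≤ k by omega),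
    rootNorm_bonacciPoly_two_mul_X_sub_one (show 1 ≤ k by omega)] at hnorm
  rw [← rootNorm_bonacciPoly_denominator k (by omega), mul_pow (rootNorm _ _), ← hnorm, pow_two,
    ← mul_assoc, mul_pow _ _ y]
  ring

theorem rootNorm_bonacciPoly_trinomial_lt {k : ℕ} (hk : 2 ≤ k) {α : ℝ} (hα : 1 < α)
    (hroot : α ^ k = ∑ i ∈ Finset.range k, α ^ i) {y : ℕ} (hy : 1 ≤ y) :
    rootNorm (bonacciPoly k) (X ^ (2 * (y + 1)) + X ^ (y + 1) - 1)
      < 5 * 4 ^ y * 3 ^ (k - 1) := by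
  have hα2 : α < 2 := by
    have h := sub_one_mul_aeval_bonacciPoly k α
    rw [aeval_bonacciPoly, hroot, sub_self, mul_zero, ← hroot] at h
    have : 0 < α ^ k := by positivity
    nlinarith
  refine (rootNorm_bonacciPoly_le hk hα hroot _ (c := 3) (by norm_num) fun z hz => ?_).trans_lt ?_
  · simp only [map_sub, map_add, map_pow, aeval_X, map_one]
    have h1 (n : ℕ) : ‖z ^ n‖ ≤ 1 := by
      rw [norm_pow]; exact pow_le_one₀ (norm_nonneg _) hz.le
    calc ‖z ^ (2 * (y + 1)) + z ^ (y + 1) - 1‖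
        ≤ ‖z ^ (2 * (y + 1))‖ + ‖z ^ (y + 1)‖ + ‖(1 : ℂ)‖ :=
          (norm_sub_le _ _).trans (by gcongr; exact norm_add_le _ _)
      _ ≤ 1 + 1 + 1 := by rw [norm_one]; gcongr <;> exact h1 _
      _ = 3 := by norm_num
  · simp only [map_sub, map_add, map_pow, aeval_X, map_one]
    gcongr
    have h1 : 1 ≤ α ^ (y + 1) := one_le_pow₀ hα.le
    have h2 : α ^ (y + 1) ≤ 2 ^ (y + 1) := by gcongr
    have h3 : (2 : ℝ) ≤ 2 ^ y := by simpa using pow_le_pow_right₀ (one_le_two (α := ℝ)) hy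
    have h4 : (4 : ℝ) ^ y = 2 ^ y * 2 ^ y := by rw [← mul_pow]; norm_num
    rw [pow_succ 2 y] at h2
    rw [mul_comm 2, pow_mul, abs_of_nonneg (by nlinarith), h4]
    nlinarith

theorem gamma_five_ne_one (k : ℕ) (hk : 2 ≤ k) (α : ℝ) (hα : 1 < α)
    (hroot : α ^ k = ∑ i ∈ Finset.range k, α ^ i)
    (x n : ℕ) (m : ℤ) (hx : 2 ≤ x) (hn : 4 ≤ n) :
    ((2 * α - 1) * fk k α) ^ (x - 1)
        * α ^ (((n : ℤ) - 1) * (x : ℤ) - (m - 1))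
        * (1 + α ^ (-(x : ℤ)) - α ^ (-(2 * (x : ℤ)))) ≠ 1 := by
  obtain ⟨y, rfl⟩ := Nat.exists_eq_add_of_le' (show 1 ≤ x by omega)
  rw [Nat.add_sub_cancel]
  generalize ((n : ℤ) - 1) * ((y + 1 : ℕ) : ℤ) - (m - 1) = e
  obtain rfl | hk3 := hk.eq_or_lt
  · have hroot' : α ^ 2 = α + 1 := by rw [hroot]; simp [Finset.sum_range_succ, add_comm]
    have hf : (2 * α - 1) * fk 2 α = α := by
      have hd : (2 : ℝ) + ((2 : ℕ) + 1) * (α - 2) ≠ 0 := by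
        push_cast; nlinarith
      rw [fk, ← mul_div_assoc, div_eq_iff hd]
      push_cast
      linear_combination -hroot'
    rw [hf, ← zpow_natCast, ← zpow_add₀ (by linarith)]
    exact zpow_mul_one_add_ne_one hα hroot' hx _
  intro h
  have hnorm := rootNorm_eq_of_gamma_five_eq_one hk hα hroot (by omega) h
  obtain hk7 | hk7 := Nat.lt_or_ge k 7
  · rw [(bonacciPoly_monic k).rootNorm_eq_natAbs_resultant] at hnorm
    obtain ⟨A, B, hA, hB, hAB⟩ : ∃ A B : ℕ, ((2 : ℝ) ^ (k + 1) - 3) * (k - 1) ^ 2 = A ∧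
        |(2 : ℝ) ^ (k + 1) * k ^ k - (k + 1) ^ (k + 1)| = B ∧ ¬A ∣ B := by
      interval_cases k
      · exact ⟨52, 176, by norm_num, by norm_num, by norm_num⟩
      · exact ⟨261, 5067, by norm_num, by norm_num, by norm_num⟩
      · exact ⟨976, 153344, by norm_num, by norm_num, by norm_num⟩
      · exact ⟨3125, 5148425, by norm_num, by norm_num, by norm_num⟩
    rw [hA, hB] at hnorm
    have hdvd : A ^ y ∣ B ^ y := ⟨_, by exact_mod_cast hnorm.symm⟩
    exact hAB ((Nat.pow_dvd_pow_iff (by omega)).1 hdvd)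
  · have hlt := rootNorm_bonacciPoly_trinomial_lt hk hα hroot (show 1 ≤ y by omega)
    have hle := twenty_mul_three_pow_mul_le hk7
    have h7 : (7 : ℝ) ≤ k := by exact_mod_cast hk7
    have h2 : (2 : ℝ) ^ 2 ≤ 2 ^ (k + 1) := pow_le_pow_right₀ (by norm_num) (by omega)
    have hC : 0 < ((2 : ℝ) ^ (k + 1) - 3) * (k - 1) ^ 2 :=
      mul_pos (by linarith) (pow_pos (by linarith) 2)
    generalize ((2 : ℝ) ^ (k + 1) - 3) * (k - 1) ^ 2 = c at hnorm hle hC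
    refine hnorm.not_lt ?_
    calc c ^ y * rootNorm (bonacciPoly k) (X ^ (2 * (y + 1)) + X ^ (y + 1) - 1)
        < c ^ y * (5 * 4 ^ y * 3 ^ (k - 1)) := by gcongr
      _ = (4 * c) ^ y * (5 * 3 ^ (k - 1)) := by rw [mul_pow]; ring
      _ ≤ (4 * c) ^ y * (5 * 3 ^ (k - 1)) ^ y := by
          gcongr
          refine le_self_pow₀ ?_ (by omega)
          have : (1 : ℝ) ≤ 3 ^ (k - 1) := one_le_pow₀ (by norm_num)
          linarith
      _ = (20 * 3 ^ (k - 1) * c) ^ y := by rw [← mul_pow]; ring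
      _ ≤ _ := by gcongr; exact hle.trans (le_abs_self _)
end
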